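/- For n ≥ 1, the based loop space Ω(HP^n) is homotopy equivalent to the product Ω(S^{4n+3}) × S^3. -/

import Mathlib

open ContinuousMap
open scoped Quaternion

/-- The quotient topology on the quaternionic projective space
`HP^n = ℙ(ℍ, ℍ^{n+1})`. -/
noncomputable instance quaternionicProjectiveSpace.topologicalSpace (n : ℕ) :
    TopologicalSpace (Projectivization ℍ[ℝ] (Fin (n + 1) → ℍ[ℝ])) :=
  inferInstanceAs (TopologicalSpace (Quotient (projectivizationSetoid ℍ[ℝ] (Fin (n + 1) → ℍ[ℝ]))))

open scoped unitInterval

section Paths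

variable {G X Y : Type*} [TopologicalSpace X] [TopologicalSpace Y]

/-- The space of pairs `(g, γ)` of a parameter `g` and a path `γ` from `x` to `a g`, i.e. the
pullback of the path fibration of `X` at `x` along `a`. -/
abbrev PathsTo (x : X) (a : G → X) : Type _ :=
  {p : G × C(I, X) // p.2 0 = x ∧ p.2 1 = a p.1}

namespace PathsTo

variable {x : X} {a b : G → X}

/-- The parameter of a point of `PathsTo x a`. -/
def param (p : PathsTo x a) : G := p.1.1

/-- The path underlying a point of `PathsTo x a`. -/
def path (p : PathsTo x a) : Path x (a p.param) where
  toContinuousMap := p.1.2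
  source' := p.2.1
  target' := p.2.2

/-- Build a point of `PathsTo x a`. -/
def of (g : G) (γ : Path x (a g)) : PathsTo x a :=
  ⟨(g, γ.toContinuousMap), γ.source, γ.target⟩

@[simp] lemma of_path (g : G) (γ : Path x (a g)) (t : I) : (of g γ).path t = γ t := rfl

@[simp] lemma of_param (g : G) (γ : Path x (a g)) : (of g γ).param = g := rfl

lemma ext' {p q : PathsTo x a} (hg : p.param = q.param) (h : ∀ t, p.path t = q.path t) : p = q :=
  Subtype.ext (Prod.ext hg (ContinuousMap.ext h))

variable [TopologicalSpace G]

@[fun_prop]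
lemma continuous_param : Continuous (param : PathsTo x a → G) :=
  continuous_fst.comp continuous_subtype_val

lemma continuous_path_eval : Continuous fun q : PathsTo x a × I => q.1.path q.2 := by
  change Continuous fun q : PathsTo x a × I => q.1.1.2 q.2
  fun_prop

lemma continuous_of {g : Y → G} {γ : ∀ y, Path x (a (g y))} (hg : Continuous g)
    (hγ : Continuous fun q : Y × I => γ q.1 q.2) : Continuous fun y => of (g y) (γ y) :=
  (hg.prodMk (ContinuousMap.continuous_of_continuous_uncurry _ hγ)).subtype_mk _

/-- Concatenation with a continuous family of paths from `a g` to `b g`. -/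
noncomputable def concat (h : ∀ g, Path (a g) (b g)) (hh : Continuous fun q : G × I => h q.1 q.2) :
    C(PathsTo x a, PathsTo x b) where
  toFun p := of p.param (p.path.trans (h p.param))
  continuous_toFun := continuous_of continuous_param <|
    Path.trans_continuous_family (fun p : PathsTo x a => p.path) continuous_path_eval
      (fun p => h p.param) (hh.comp (by fun_prop : Continuous fun q : PathsTo x a × I =>
        (q.1.param, q.2)))

lemma trans_trans_symm_apply {x y z : X} (γ : Path x y) (δ : Path y z) (t : I) :
    ((γ.trans δ).trans δ.symm) t = (γ.trans δ).extend (min (2 * t) ((3 - 2 * t) / 2)) := by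
  have ht0 := t.2.1
  have ht1 := t.2.2
  rw [Path.trans_apply]
  split_ifs with ht
  · rw [min_eq_left (by linarith), Path.extend_apply _ ⟨by linarith, by linarith⟩]
  · rw [min_eq_right (by linarith), Path.extend_apply _ ⟨by linarith, by linarith⟩,
      Path.trans_apply, Path.symm_apply]
    split_ifs with ht2
    · have : (t : ℝ) = 1 := by
        simp only at ht2
        linarith
      have hδ (u : I) (hu : (u : ℝ) = 0) : δ u = y := by
        rw [show u = 0 from Subtype.ext hu, δ.source]
      have hγ (u : I) (hu : (u : ℝ) = 1) : γ u = y := by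
        rw [show u = 1 from Subtype.ext hu, γ.target]
      refine (hδ _ ?_).trans (hγ _ ?_).symm
      · simp only [unitInterval.coe_symm_eq]
        linarith
      · simp only
        linarith
    · refine congrArg δ (Subtype.ext ?_)
      simp only [unitInterval.coe_symm_eq]
      ring

lemma trans_extend_half {x y z : X} (γ : Path x y) (δ : Path y z) (t : I) :
    (γ.trans δ).extend (t / 2) = γ t := by
  have ht0 := t.2.1
  have ht1 := t.2.2
  rw [Path.extend_apply _ ⟨by linarith, by linarith⟩, Path.trans_apply,
    dif_pos (by simp only; linarith)]
  congr 1
  ext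
  simp only
  ring

lemma concat_symm_homotopic (h : ∀ g, Path (a g) (b g))
    (hh : Continuous fun q : G × I => h q.1 q.2)
    (hh' : Continuous fun q : G × I => (h q.1).symm q.2) :
    ((concat (x := x) (fun g => (h g).symm) hh').comp (concat h hh)).Homotopic (.id _) := by
  have hc : Continuous fun q : PathsTo x a × I => (q.1.path.trans (h q.1.param)) q.2 :=
    Path.trans_continuous_family (fun p : PathsTo x a => p.path) continuous_path_eval
      (fun p => h p.param) (hh.comp (by fun_prop : Continuous fun q : PathsTo x a × I =>
        (q.1.param, q.2)))
  have he : Continuous fun q : (I × PathsTo x a) × I =>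
      (q.1.2.path.trans (h q.1.2.param)).extend
        ((1 - q.1.1) * min (2 * (q.2 : ℝ)) ((3 - 2 * q.2) / 2) + q.1.1 * (q.2 / 2) : ℝ) := by
    refine hc.comp (f := fun q : (I × PathsTo x a) × I =>
      (q.1.2, Set.projIcc (0 : ℝ) 1 zero_le_one
        ((1 - q.1.1) * min (2 * (q.2 : ℝ)) ((3 - 2 * q.2) / 2) + q.1.1 * (q.2 / 2) : ℝ))) ?_
    exact (by fun_prop : Continuous fun q : (I × PathsTo x a) × I => q.1.2).prodMk
      (continuous_projIcc.comp (by fun_prop))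
  have h0 (q : I × PathsTo x a) : (q.2.path.trans (h q.2.param)).extend
      ((1 - q.1) * min (2 * ((0 : I) : ℝ)) ((3 - 2 * (0 : I)) / 2) + q.1 * ((0 : I) / 2) : ℝ)
        = x := by
    norm_num
  have h1 (q : I × PathsTo x a) : (q.2.path.trans (h q.2.param)).extend
      ((1 - q.1) * min (2 * ((1 : I) : ℝ)) ((3 - 2 * (1 : I)) / 2) + q.1 * ((1 : I) / 2) : ℝ)
        = a q.2.param := by
    have : ((1 - q.1) * min (2 * ((1 : I) : ℝ)) ((3 - 2 * (1 : I)) / 2) + q.1 * ((1 : I) / 2) : ℝ)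
        = (1 : I) / 2 := by
      rw [min_eq_right] <;> norm_num
      ring
    rw [this, trans_extend_half, Path.target]
  let K (q : I × PathsTo x a) : Path x (a q.2.param) :=
    ⟨⟨fun t => (q.2.path.trans (h q.2.param)).extend
      ((1 - q.1) * min (2 * (t : ℝ)) ((3 - 2 * t) / 2) + q.1 * (t / 2) : ℝ),
      (q.2.path.trans (h q.2.param)).continuous_extend.comp (by fun_prop)⟩, h0 q, h1 q⟩
  have hK : Continuous fun q : I × PathsTo x a => of q.2.param (K q) :=
    continuous_of (by fun_prop) he
  refine ⟨⟨⟨_, hK⟩, ?_, ?_⟩⟩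
  · intro p
    refine ext' rfl fun t => ?_
    change (p.path.trans (h p.param)).extend _ =
      ((p.path.trans (h p.param)).trans (h p.param).symm) t
    rw [trans_trans_symm_apply]
    simp
  · intro p
    refine ext' rfl fun t => ?_
    change (p.path.trans (h p.param)).extend _ = p.path t
    rw [← trans_extend_half p.path (h p.param)]
    simp

/-- Homotopic maps have homotopy equivalent spaces of paths ending on them. -/
noncomputable def concatEquiv (h : ∀ g, Path (a g) (b g))
    (hh : Continuous fun q : G × I => h q.1 q.2) :
    PathsTo x a ≃ₕ PathsTo x b :=
  have hh' : Continuous fun q : G × I => (h q.1).symm q.2 := Path.symm_continuous_family h hh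
  { toFun := concat h hh
    invFun := concat (fun g => (h g).symm) hh'
    left_inv := concat_symm_homotopic h hh hh'
    right_inv := by
      have key := concat_symm_homotopic (x := x) (fun g => (h g).symm) hh'
        (by simpa only [Path.symm_symm] using hh)
      simpa only [Path.symm_symm] using key }

/-- Over a constant map the space of paths is a product. -/
def constHomeomorph (x y : X) : PathsTo x (fun _ : G => y) ≃ₜ G × Path x y where
  toFun p := (p.param, p.path)
  invFun q := of q.1 q.2
  left_inv _ := rfl
  right_inv _ := rfl
  continuous_toFun := continuous_param.prodMk (Path.continuous_uncurry_iff.1 continuous_path_eval)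
  continuous_invFun := continuous_of continuous_fst (by fun_prop)

end PathsTo

/-- Reversal of paths as a homeomorphism. -/
def Path.symmHomeomorph (x y : X) : Path x y ≃ₜ Path y x where
  toFun := Path.symm
  invFun := Path.symm
  left_inv := Path.symm_symm
  right_inv := Path.symm_symm
  continuous_toFun := Path.continuous_symm
  continuous_invFun := Path.continuous_symm

/-- Concatenation with a fixed path is a homotopy equivalence of path spaces. -/
noncomputable def Path.targetEquiv (x : X) {y z : X} (δ : Path y z) : Path x y ≃ₕ Path x z :=
  have e (w : X) : Path x w ≃ₕ PathsTo x (fun _ : Unit => w) :=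
    ((PathsTo.constHomeomorph (G := Unit) x w).trans
      (Homeomorph.punitProd (Path x w))).symm.toHomotopyEquiv
  ((e y).trans (PathsTo.concatEquiv (fun _ => δ) (by fun_prop))).trans (e z).symm

lemma nonempty_path_homotopyEquiv [PathConnectedSpace X] (x y x' y' : X) :
    Nonempty (Path x y ≃ₕ Path x' y') := by
  obtain ⟨γ⟩ := PathConnectedSpace.joined x x'
  obtain ⟨δ⟩ := PathConnectedSpace.joined y y'
  exact ⟨((Path.targetEquiv x δ).trans (Path.symmHomeomorph x y').toHomotopyEquiv).trans
    ((Path.targetEquiv y' γ).trans (Path.symmHomeomorph y' x').toHomotopyEquiv)⟩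

/-- A homeomorphism induces homeomorphisms of path spaces. -/
def Homeomorph.pathCongr (e : X ≃ₜ Y) (x y : X) : Path x y ≃ₜ Path (e x) (e y) where
  toFun γ := γ.map e.continuous
  invFun γ := (γ.map e.symm.continuous).cast (by simp) (by simp)
  left_inv γ := by ext; simp
  right_inv γ := by ext; simp
  continuous_toFun := Path.continuous_uncurry_iff.1 (by
    change Continuous fun q : Path x y × I => e (q.1 q.2)
    fun_prop)
  continuous_invFun := Path.continuous_uncurry_iff.1 (by
    change Continuous fun q : Path (e x) (e y) × I => e.symm (q.1 q.2)
    fun_prop)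

end Paths

section Sphere

lemma homotopic_of_eq {A X : Type*} [TopologicalSpace A] [TopologicalSpace X] {f g : C(A, X)}
    (h : f = g) : f.Homotopic g :=
  h ▸ .refl f

variable {A X : Type*} [TopologicalSpace A] [TopologicalSpace X]

/-- A strong deformation retraction induces homotopy equivalences of path spaces. -/
def pathEquivOfDeformationRetraction (i : C(A, X)) (r : C(X, A)) (hr : ∀ a, r (i a) = a)
    (H : (i.comp r).Homotopy (.id X)) (hH : ∀ t a, H (t, i a) = i a) (a b : A) :
    Path a b ≃ₕ Path (i a) (i b) where
  toFun :=
    { toFun := fun γ => γ.map i.continuous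
      continuous_toFun := Path.continuous_uncurry_iff.1 (by
        change Continuous fun q : Path a b × I => i (q.1 q.2)
        fun_prop) }
  invFun :=
    { toFun := fun γ => (γ.map r.continuous).cast (hr a).symm (hr b).symm
      continuous_toFun := Path.continuous_uncurry_iff.1 (by
        change Continuous fun q : Path (i a) (i b) × I => r (q.1 q.2)
        fun_prop) }
  left_inv := by
    refine homotopic_of_eq (ContinuousMap.ext fun γ => ?_)
    ext t
    exact hr _
  right_inv := ⟨
    { toFun := fun q =>
        { toFun := fun t => H (q.1, q.2 t)
          continuous_toFun := by fun_prop
          source' := by simp [hH]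
          target' := by simp [hH] }
      continuous_toFun := Path.continuous_uncurry_iff.1 (by
        change Continuous fun q : (I × Path (i a) (i b)) × I => H (q.1.1, q.1.2 q.2)
        fun_prop)
      map_zero_left := fun γ => by
        ext t
        exact H.map_zero_left _
      map_one_left := fun γ => by
        ext t
        exact H.map_one_left _ }⟩

variable (W : Type*) [NormedAddCommGroup W] [NormedSpace ℝ W]

/-- The inclusion of the unit sphere into the complement of the origin. -/
def sphereInclusion : C(Metric.sphere (0 : W) 1, {w : W // w ≠ 0}) where
  toFun s := ⟨s, ne_zero_of_mem_unit_sphere s⟩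

variable {W} in
lemma inv_norm_smul_mem_sphere {w : W} (hw : w ≠ 0) : ‖w‖⁻¹ • w ∈ Metric.sphere (0 : W) 1 := by
  rw [mem_sphere_zero_iff_norm, norm_smul, norm_inv, norm_norm,
    inv_mul_cancel₀ (norm_ne_zero_iff.2 hw)]

/-- Radial projection onto the unit sphere. -/
noncomputable def radialProjection : C({w : W // w ≠ 0}, Metric.sphere (0 : W) 1) where
  toFun w := ⟨‖w.1‖⁻¹ • w.1, inv_norm_smul_mem_sphere w.2⟩
  continuous_toFun := by
    have : Continuous fun w : {w : W // w ≠ 0} => ‖w.1‖⁻¹ :=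
      Continuous.inv₀ (by fun_prop) fun w => norm_ne_zero_iff.2 w.2
    exact Continuous.subtype_mk (by fun_prop) _

lemma radialProjection_sphereInclusion (s : Metric.sphere (0 : W) 1) :
    radialProjection W (sphereInclusion W s) = s := by
  ext
  simp [radialProjection, sphereInclusion]

/-- The radial deformation of the complement of the origin onto the unit sphere. -/
noncomputable def radialHomotopy :
    ((sphereInclusion W).comp (radialProjection W)).Homotopy (.id _) where
  toFun q := ⟨((1 - q.1) * ‖q.2.1‖⁻¹ + q.1 : ℝ) • q.2.1, by
    have h0 := q.1.2.1
    have h1 := q.1.2.2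
    have hw : 0 < ‖q.2.1‖⁻¹ := inv_pos.2 (norm_pos_iff.2 q.2.2)
    refine smul_ne_zero (ne_of_gt ?_) q.2.2
    rcases h0.eq_or_lt with h | h
    · rw [← h]
      simpa using q.2.2
    · exact add_pos_of_nonneg_of_pos (mul_nonneg (by linarith) hw.le) h⟩
  continuous_toFun := by
    have : Continuous fun q : I × {w : W // w ≠ 0} => ‖q.2.1‖⁻¹ :=
      Continuous.inv₀ (by fun_prop) fun q => norm_ne_zero_iff.2 q.2.2
    exact Continuous.subtype_mk (by fun_prop) _
  map_zero_left w := by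
    ext
    simp [radialProjection, sphereInclusion]
  map_one_left w := by
    ext
    simp

/-- The unit sphere is homotopy equivalent to the complement of the origin. -/
noncomputable def sphereEquiv : Metric.sphere (0 : W) 1 ≃ₕ {w : W // w ≠ 0} where
  toFun := sphereInclusion W
  invFun := radialProjection W
  left_inv := homotopic_of_eq (ContinuousMap.ext (radialProjection_sphereInclusion W))
  right_inv := ⟨radialHomotopy W⟩

/-- Path spaces of the unit sphere and of the complement of the origin agree. -/
noncomputable def spherePathEquiv (s t : Metric.sphere (0 : W) 1) :
    Path s t ≃ₕ Path (sphereInclusion W s) (sphereInclusion W t) :=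
  pathEquivOfDeformationRetraction (sphereInclusion W) (radialProjection W)
    (radialProjection_sphereInclusion W) (radialHomotopy W)
    (fun t a => by
      refine Subtype.ext ?_
      change ((1 - t) * ‖a.1‖⁻¹ + t : ℝ) • a.1 = a.1
      simp) s t

variable {W}
variable {V : Type*} [NormedAddCommGroup V] [NormedSpace ℝ V] [FiniteDimensional ℝ V]
  [FiniteDimensional ℝ W]

/-- Complements of the origin in spaces of the same dimension are homeomorphic. -/
noncomputable def neZeroHomeomorph (h : Module.finrank ℝ V = Module.finrank ℝ W) :
    {v : V // v ≠ 0} ≃ₜ {w : W // w ≠ 0} :=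
  (ContinuousLinearEquiv.ofFinrankEq h).toHomeomorph.subtype fun v => by simp

lemma pathConnectedSpace_ne_zero (h : 1 < Module.finrank ℝ V) :
    PathConnectedSpace {v : V // v ≠ 0} :=
  isPathConnected_iff_pathConnectedSpace.1 <|
    isPathConnected_compl_singleton_of_one_lt_rank
      (by rw [← Module.finrank_eq_rank]; exact_mod_cast h) (0 : V)

lemma nonempty_path_ne_zero_equiv_sphere (h : Module.finrank ℝ V = Module.finrank ℝ W)
    (h1 : 1 < Module.finrank ℝ V) (v v' : {v : V // v ≠ 0}) (s : Metric.sphere (0 : W) 1) :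
    Nonempty (Path v v' ≃ₕ Path s s) := by
  have := pathConnectedSpace_ne_zero (V := W) (h ▸ h1)
  obtain ⟨e⟩ := nonempty_path_homotopyEquiv (neZeroHomeomorph h v) (neZeroHomeomorph h v')
    (sphereInclusion W s) (sphereInclusion W s)
  exact ⟨(((neZeroHomeomorph h).pathCongr v v').toHomotopyEquiv.trans e).trans
    (spherePathEquiv W s s).symm⟩

end Sphere

section QuaternionicProjectiveSpace

variable {n : ℕ}

local notation "HV" n => (Fin (n + 1) → ℍ[ℝ])
local notation "HP" n => Projectivization ℍ[ℝ] (Fin (n + 1) → ℍ[ℝ])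

namespace QuaternionicProjectiveSpace

/-- The squared Euclidean norm of a quaternionic vector. -/
noncomputable def sqNorm (w : HV n) : ℝ := ∑ i, Quaternion.normSq (w i)

lemma sqNorm_ne_zero {w : HV n} (hw : w ≠ 0) : sqNorm w ≠ 0 := by
  intro h
  refine hw (funext fun i => ?_)
  rw [sqNorm, Finset.sum_eq_zero_iff_of_nonneg fun _ _ => Quaternion.normSq_nonneg] at h
  exact Quaternion.normSq_eq_zero.1 (h i (Finset.mem_univ i))

lemma sqNorm_smul (g : ℍ[ℝ]) (w : HV n) : sqNorm (g • w) = Quaternion.normSq g * sqNorm w := by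
  simp [sqNorm, Finset.mul_sum]

@[fun_prop]
lemma continuous_sqNorm : Continuous (sqNorm : (HV n) → ℝ) := by
  unfold sqNorm
  have := Quaternion.continuous_normSq
  fun_prop

/-- The left quaternionic coefficient of the orthogonal projection of `v` to the line of `w`. -/
noncomputable def coeff (v w : HV n) : ℍ[ℝ] := (sqNorm w)⁻¹ • ∑ i, v i * star (w i)

lemma coeff_smul_self {w : HV n} (hw : w ≠ 0) (g : ℍ[ℝ]) : coeff (g • w) w = g := by
  have : ∑ i, (g • w) i * star (w i) = (sqNorm w) • g := by
    simp only [Pi.smul_apply, smul_eq_mul, mul_assoc, Quaternion.self_mul_star]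
    rw [← Finset.mul_sum, sqNorm, Finset.sum_smul, Finset.mul_sum]
    exact Finset.sum_congr rfl fun i _ => by
      rw [← Quaternion.coe_commutes, Quaternion.coe_mul_eq_smul]
  rw [coeff, this, smul_smul, inv_mul_cancel₀ (sqNorm_ne_zero hw), one_smul]

lemma coeff_smul_of_mk_eq {v w : HV n} (hv : v ≠ 0) (hw : w ≠ 0)
    (h : Projectivization.mk ℍ[ℝ] v hv = Projectivization.mk ℍ[ℝ] w hw) : coeff v w • w = v := by
  obtain ⟨g, rfl⟩ := (Projectivization.mk_eq_mk_iff' _ _ _ hv hw).1 h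
  rw [coeff_smul_self hw]

lemma coeff_ne_zero_of_mk_eq {v w : HV n} (hv : v ≠ 0) (hw : w ≠ 0)
    (h : Projectivization.mk ℍ[ℝ] v hv = Projectivization.mk ℍ[ℝ] w hw) : coeff v w ≠ 0 := by
  intro h0
  have := coeff_smul_of_mk_eq hv hw h
  rw [h0, zero_smul] at this
  exact hv this.symm

lemma continuous_coeff {Y : Type*} [TopologicalSpace Y] {f g : Y → HV n} (hf : Continuous f)
    (hg : Continuous g) (h : ∀ y, g y ≠ 0) : Continuous fun y => coeff (f y) (g y) := by
  unfold coeff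
  have : Continuous fun y => (sqNorm (g y))⁻¹ :=
    (continuous_sqNorm.comp hg).inv₀ fun y => sqNorm_ne_zero (h y)
  fun_prop

/-- The matrix of the orthogonal projection to a quaternionic line. -/
noncomputable def projMatrix : (HP n) → Fin (n + 1) → Fin (n + 1) → ℍ[ℝ] :=
  Projectivization.lift (fun w i j => (sqNorm w.1)⁻¹ • (star (w.1 i) * w.1 j)) <| by
    rintro ⟨v, hv⟩ ⟨w, hw⟩ g (rfl : v = g • w)
    have hg : Quaternion.normSq g ≠ 0 := by
      rintro h
      rw [Quaternion.normSq_eq_zero] at h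
      simp [h] at hv
    funext i j
    have : star ((g • w) i) * (g • w) j = Quaternion.normSq g • (star (w i) * w j) := by
      simp only [Pi.smul_apply, smul_eq_mul, star_mul]
      rw [mul_assoc, ← mul_assoc (star g), Quaternion.star_mul_self, Quaternion.coe_mul_eq_smul,
        mul_smul_comm]
    simp only
    rw [this, sqNorm_smul, smul_smul, mul_inv_rev, mul_assoc, inv_mul_cancel₀ hg, mul_one]

lemma projMatrix_mk {w : HV n} (hw : w ≠ 0) (i j : Fin (n + 1)) :
    projMatrix (Projectivization.mk ℍ[ℝ] w hw) i j = (sqNorm w)⁻¹ • (star (w i) * w j) := rfl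

@[fun_prop]
lemma continuous_mk' : Continuous (Projectivization.mk' ℍ[ℝ] : {w : HV n // w ≠ 0} → HP n) :=
  continuous_quotient_mk'

@[fun_prop]
lemma continuous_projMatrix : Continuous (projMatrix : (HP n) → _) := by
  refine Continuous.quotient_lift (f := fun w : {w : HV n // w ≠ 0} => fun i j =>
    (sqNorm w.1)⁻¹ • (star (w.1 i) * w.1 j)) ?_ _
  have : Continuous fun w : {w : HV n // w ≠ 0} => (sqNorm w.1)⁻¹ :=
    (continuous_sqNorm.comp continuous_subtype_val).inv₀ fun w => sqNorm_ne_zero w.2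
  exact continuous_pi fun i => continuous_pi fun j => this.smul <|
    (continuous_star.comp ((continuous_apply i).comp continuous_subtype_val)).mul
      ((continuous_apply j).comp continuous_subtype_val)

/-- The orthogonal projection of `v` to the line `b`. -/
noncomputable def transport (v : HV n) (b : HP n) : HV n := fun j => ∑ i, v i * projMatrix b i j

@[fun_prop]
lemma continuous_transport {Y : Type*} [TopologicalSpace Y] {f : Y → HV n} {g : Y → HP n}
    (hf : Continuous f) (hg : Continuous g) : Continuous fun y => transport (f y) (g y) := by
  unfold transport
  have := continuous_projMatrix.comp hg
  simp only [Function.comp_def] at this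
  fun_prop

lemma transport_mk (v : HV n) {w : HV n} (hw : w ≠ 0) :
    transport v (Projectivization.mk ℍ[ℝ] w hw) = coeff v w • w := by
  funext j
  simp only [transport, projMatrix_mk, coeff, Pi.smul_apply, smul_eq_mul, smul_mul_assoc,
    Finset.sum_mul, mul_smul_comm, ← Finset.smul_sum, mul_assoc]

lemma transport_self {w : HV n} (hw : w ≠ 0) :
    transport w (Projectivization.mk ℍ[ℝ] w hw) = w := by
  rw [transport_mk w hw, coeff_smul_of_mk_eq hw hw rfl]

/-- A measure of non-orthogonality of two quaternionic lines. -/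
noncomputable def overlap (b c : HP n) : ℝ :=
  ‖fun i j => ∑ k, projMatrix b i k * projMatrix c k j‖

@[fun_prop]
lemma continuous_overlap {Y : Type*} [TopologicalSpace Y] {f g : Y → HP n}
    (hf : Continuous f) (hg : Continuous g) : Continuous fun y => overlap (f y) (g y) := by
  unfold overlap
  have h1 := continuous_projMatrix.comp hf
  have h2 := continuous_projMatrix.comp hg
  simp only [Function.comp_def] at h1 h2
  fun_prop

lemma overlap_eq_zero_iff {w : HV n} (hw : w ≠ 0) (c : HP n) :
    overlap (Projectivization.mk ℍ[ℝ] w hw) c = 0 ↔ transport w c = 0 := by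
  have key (i j) : ∑ k, projMatrix (Projectivization.mk ℍ[ℝ] w hw) i k * projMatrix c k j =
      (sqNorm w)⁻¹ • (star (w i) * transport w c j) := by
    simp only [projMatrix_mk, transport, smul_mul_assoc, Finset.mul_sum, Finset.smul_sum,
      mul_assoc]
  rw [overlap, norm_eq_zero]
  simp only [key]
  constructor
  · intro h
    obtain ⟨i, hi⟩ := Function.ne_iff.1 hw
    funext j
    have := congrFun (congrFun h i) j
    simpa [sqNorm_ne_zero hw, show w i ≠ 0 from hi] using this
  · intro h
    simp only [h, Pi.zero_apply, mul_zero, smul_zero]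
    rfl

lemma overlap_nonneg (b c : HP n) : 0 ≤ overlap b c := norm_nonneg _

lemma overlap_self_pos (b : HP n) : 0 < overlap b b := by
  induction b using Projectivization.ind with
  | h w hw =>
    refine lt_of_le_of_ne (overlap_nonneg _ _) fun h => hw ?_
    rw [← transport_self hw]
    exact (overlap_eq_zero_iff hw _).1 h.symm

lemma exists_mk_transport_eq {v : HV n} (hv : v ≠ 0) {c : HP n}
    (h : 0 < overlap (Projectivization.mk ℍ[ℝ] v hv) c) :
    ∃ hne : transport v c ≠ 0, Projectivization.mk ℍ[ℝ] (transport v c) hne = c := by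
  have hne : transport v c ≠ 0 := fun h0 => h.ne' ((overlap_eq_zero_iff hv c).2 h0)
  refine ⟨hne, ?_⟩
  induction c using Projectivization.ind with
  | h w hw =>
    exact (Projectivization.mk_eq_mk_iff' _ _ _ _ _).2 ⟨coeff v w, (transport_mk v hw).symm⟩

variable {y : HP n}

/-- A step size for which subdivisions of `γ` can be lifted by `transport`. -/
noncomputable def stepSize (γ : Path y y) : ℝ :=
  sInf ((fun q : I × I => |(q.1 : ℝ) - q.2| + overlap (γ q.1) (γ q.2)) '' Set.univ)

lemma continuous_stepSize : Continuous (stepSize : Path y y → ℝ) := by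
  refine isCompact_univ.continuous_sInf
    (f := fun (γ : Path y y) (q : I × I) => |(q.1 : ℝ) - q.2| + overlap (γ q.1) (γ q.2)) ?_
  change Continuous fun p : Path y y × I × I =>
    |(p.2.1 : ℝ) - p.2.2| + overlap (p.1 p.2.1) (p.1 p.2.2)
  fun_prop

lemma stepSize_le (γ : Path y y) (s t : I) :
    stepSize γ ≤ |(s : ℝ) - t| + overlap (γ s) (γ t) := by
  refine csInf_le ⟨0, ?_⟩ ⟨(s, t), Set.mem_univ _, rfl⟩
  rintro _ ⟨q, -, rfl⟩
  exact add_nonneg (abs_nonneg _) (overlap_nonneg _ _)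

lemma stepSize_pos (γ : Path y y) : 0 < stepSize γ := by
  have hc : Continuous fun q : I × I => |(q.1 : ℝ) - q.2| + overlap (γ q.1) (γ q.2) := by
    fun_prop
  obtain ⟨q, -, hq⟩ := (isCompact_univ.image hc).sInf_mem (Set.univ_nonempty.image _)
  rw [stepSize, ← hq]
  simp only
  by_cases h : q.1 = q.2
  · rw [h]
    exact add_pos_of_nonneg_of_pos (abs_nonneg _) (overlap_self_pos _)
  · exact add_pos_of_pos_of_nonneg
      (abs_pos.2 (sub_ne_zero.2 fun h' => h (Subtype.ext h'))) (overlap_nonneg _ _)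

/-- The time `t`, capped after `k` half steps. -/
noncomputable def cappedTime (γ : Path y y) (k : ℕ) (t : I) : I :=
  Set.projIcc 0 1 zero_le_one (min (t : ℝ) (k * (stepSize γ / 2)))

lemma coe_cappedTime (γ : Path y y) (k : ℕ) (t : I) :
    (cappedTime γ k t : ℝ) = min (t : ℝ) (k * (stepSize γ / 2)) := by
  have := stepSize_pos γ
  rw [cappedTime, Set.projIcc_of_mem _ ⟨le_min t.2.1 (by positivity), min_le_of_left_le t.2.2⟩]

lemma cappedTime_of_le {γ : Path y y} {k : ℕ} {t : I} (h : (t : ℝ) ≤ k * (stepSize γ / 2)) :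
    cappedTime γ k t = t :=
  Subtype.ext <| by rw [coe_cappedTime, min_eq_left h]

lemma overlap_cappedTime_succ_pos (γ : Path y y) (k : ℕ) (t : I) :
    0 < overlap (γ (cappedTime γ k t)) (γ (cappedTime γ (k + 1) t)) := by
  have hε := stepSize_pos γ
  have h1 := stepSize_le γ (cappedTime γ k t) (cappedTime γ (k + 1) t)
  have h2 : |(cappedTime γ k t : ℝ) - cappedTime γ (k + 1) t| ≤ stepSize γ / 2 := by
    rw [coe_cappedTime, coe_cappedTime]
    refine (abs_min_sub_min_le_max _ _ _ _).trans ?_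
    push_cast
    rw [sub_self, abs_zero, add_mul, one_mul, sub_add_cancel_left, abs_neg,
      abs_of_pos (by positivity)]
    exact max_le (by positivity) le_rfl
  linarith

/-- The lift of `γ` capped after `k` half steps, starting at `v`. -/
noncomputable def partialLift (v : HV n) (γ : Path y y) : ℕ → I → HV n
  | 0, _ => v
  | k + 1, t => transport (partialLift v γ k t) (γ (cappedTime γ (k + 1) t))

lemma continuous_partialLift (v : HV n) (k : ℕ) :
    Continuous fun q : Path y y × I => partialLift v q.1 k q.2 := by
  induction k with
  | zero => exact continuous_const
  | succ k ih =>
    have h := continuous_stepSize (y := y)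
    have : Continuous fun q : Path y y × I => cappedTime q.1 (k + 1) q.2 :=
      continuous_projIcc.comp (by fun_prop)
    exact continuous_transport ih (by fun_prop)

lemma exists_mk_partialLift_eq {v : HV n} (hv : v ≠ 0) (hy : Projectivization.mk ℍ[ℝ] v hv = y)
    (γ : Path y y) (k : ℕ) (t : I) : ∃ hne : partialLift v γ k t ≠ 0,
      Projectivization.mk ℍ[ℝ] (partialLift v γ k t) hne = γ (cappedTime γ k t) := by
  induction k with
  | zero =>
    refine ⟨hv, hy.trans ?_⟩
    have : cappedTime γ 0 t = 0 := Subtype.ext <| by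
      rw [coe_cappedTime]
      simpa using t.2.1
    rw [this, γ.source]
  | succ k ih =>
    obtain ⟨hne, h⟩ := ih
    exact exists_mk_transport_eq hne (h ▸ overlap_cappedTime_succ_pos γ k t)

lemma partialLift_succ_of_le {v : HV n} (hv : v ≠ 0) (hy : Projectivization.mk ℍ[ℝ] v hv = y)
    (γ : Path y y) {k : ℕ} {t : I} (h : (t : ℝ) ≤ k * (stepSize γ / 2)) :
    partialLift v γ (k + 1) t = partialLift v γ k t := by
  have hε := stepSize_pos γ
  obtain ⟨hne, hk⟩ := exists_mk_partialLift_eq hv hy γ k t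
  have h' : (t : ℝ) ≤ (k + 1 : ℕ) * (stepSize γ / 2) := by
    push_cast
    linarith
  rw [partialLift, cappedTime_of_le h']
  rw [cappedTime_of_le h] at hk
  rw [← hk, transport_self]

lemma partialLift_of_le {v : HV n} (hv : v ≠ 0) (hy : Projectivization.mk ℍ[ℝ] v hv = y)
    (γ : Path y y) {k m : ℕ} (hkm : k ≤ m) {t : I} (h : (t : ℝ) ≤ k * (stepSize γ / 2)) :
    partialLift v γ m t = partialLift v γ k t := by
  have hε := stepSize_pos γ
  induction m, hkm using Nat.le_induction with
  | base => rfl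
  | succ m hm ih =>
    rw [partialLift_succ_of_le hv hy γ (h.trans (by gcongr)), ih]

/-- The number of half steps needed to lift all of `γ`. -/
noncomputable def stepCount (γ : Path y y) : ℕ := ⌈(stepSize γ / 2)⁻¹⌉₊

lemma le_stepCount_mul (γ : Path y y) (t : I) : (t : ℝ) ≤ stepCount γ * (stepSize γ / 2) := by
  have hε := stepSize_pos γ
  refine t.2.2.trans ?_
  rw [← div_le_iff₀ (by positivity), one_div]
  exact Nat.le_ceil _

/-- A lift of `γ` starting at `v`, depending continuously on `γ`. -/
noncomputable def lift (v : HV n) (γ : Path y y) (t : I) : HV n :=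
  partialLift v γ (stepCount γ) t

lemma exists_mk_lift_eq {v : HV n} (hv : v ≠ 0) (hy : Projectivization.mk ℍ[ℝ] v hv = y)
    (γ : Path y y) (t : I) : ∃ hne : lift v γ t ≠ 0,
      Projectivization.mk ℍ[ℝ] (lift v γ t) hne = γ t := by
  have := exists_mk_partialLift_eq hv hy γ (stepCount γ) t
  rwa [cappedTime_of_le (le_stepCount_mul γ t)] at this

lemma lift_zero {v : HV n} (hv : v ≠ 0) (hy : Projectivization.mk ℍ[ℝ] v hv = y)
    (γ : Path y y) : lift v γ 0 = v :=
  partialLift_of_le hv hy γ (Nat.zero_le _) (by simp)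

lemma continuous_lift {v : HV n} (hv : v ≠ 0) (hy : Projectivization.mk ℍ[ℝ] v hv = y) :
    Continuous fun q : Path y y × I => lift v q.1 q.2 := by
  rw [continuous_iff_continuousAt]
  intro p
  have hε := stepSize_pos p.1
  have hc : Continuous fun q : Path y y × I => stepSize q.1 :=
    continuous_stepSize.comp continuous_fst
  have key (q : Path y y × I) (hq : stepSize p.1 / 2 < stepSize q.1) :
      partialLift v q.1 ⌈(stepSize p.1 / 4)⁻¹⌉₊ q.2 = lift v q.1 q.2 := by
    refine partialLift_of_le hv hy q.1 (Nat.ceil_le_ceil ?_) (le_stepCount_mul q.1 q.2)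
    exact inv_anti₀ (by linarith) (by linarith)
  refine (continuous_partialLift v ⌈(stepSize p.1 / 4)⁻¹⌉₊).continuousAt.congr ?_
  filter_upwards [hc.continuousAt.eventually_const_lt (half_lt_self hε)] with q hq
  exact key q hq

/-- The orbit map of the nonzero quaternions through a nonzero vector. -/
noncomputable def orbit (v : {w : HV n // w ≠ 0}) (g : {g : ℍ[ℝ] // g ≠ 0}) : {w : HV n // w ≠ 0} :=
  ⟨g.1 • v.1, smul_ne_zero g.2 v.2⟩

lemma mk'_orbit (v : {w : HV n // w ≠ 0}) (g : {g : ℍ[ℝ] // g ≠ 0}) :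
    Projectivization.mk' ℍ[ℝ] (orbit v g) = Projectivization.mk' ℍ[ℝ] v :=
  (Projectivization.mk_eq_mk_iff' _ _ _ _ _).2 ⟨g.1, rfl⟩

variable {v : {w : HV n // w ≠ 0}} (hy : Projectivization.mk' ℍ[ℝ] v = y)

/-- Paths in the total space that end in the fibre project to loops. -/
noncomputable def projectPaths : C(PathsTo v (orbit v), Path y y) where
  toFun p :=
    { toFun := fun t => Projectivization.mk' ℍ[ℝ] (p.path t)
      continuous_toFun := by fun_prop
      source' := by rw [p.path.source, hy]
      target' := by rw [p.path.target, mk'_orbit, hy] }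
  continuous_toFun := Path.continuous_uncurry_iff.1 <|
    continuous_mk'.comp PathsTo.continuous_path_eval

/-- The lift of a loop as a path of nonzero vectors. -/
noncomputable def liftNeZero (γ : Path y y) (t : I) : {w : HV n // w ≠ 0} :=
  ⟨lift v.1 γ t, (exists_mk_lift_eq v.2 hy γ t).1⟩

lemma mk'_liftNeZero (γ : Path y y) (t : I) :
    Projectivization.mk' ℍ[ℝ] (liftNeZero hy γ t) = γ t :=
  (exists_mk_lift_eq v.2 hy γ t).2

lemma liftNeZero_zero (γ : Path y y) : liftNeZero hy γ 0 = v :=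
  Subtype.ext (lift_zero v.2 hy γ)

lemma continuous_liftNeZero :
    Continuous fun q : Path y y × I => liftNeZero hy q.1 q.2 :=
  (continuous_lift v.2 hy).subtype_mk _

/-- The nonzero quaternion relating two vectors on the same line. -/
noncomputable def ratio (u w : {w : HV n // w ≠ 0})
    (h : Projectivization.mk' ℍ[ℝ] u = Projectivization.mk' ℍ[ℝ] w) : {g : ℍ[ℝ] // g ≠ 0} :=
  ⟨coeff u.1 w.1, coeff_ne_zero_of_mk_eq u.2 w.2 h⟩

lemma orbit_ratio (u w : {w : HV n // w ≠ 0})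
    (h : Projectivization.mk' ℍ[ℝ] u = Projectivization.mk' ℍ[ℝ] w) :
    orbit w (ratio u w h) = u :=
  Subtype.ext (coeff_smul_of_mk_eq u.2 w.2 h)

lemma orbit_injective (w : {w : HV n // w ≠ 0}) : Function.Injective (orbit w) := by
  intro g g' h
  have := congrArg (fun u : {w : HV n // w ≠ 0} => coeff u.1 w.1) h
  simp only [orbit, coeff_smul_self w.2] at this
  exact Subtype.ext this

lemma orbit_eq_iff_ratio {u w : {w : HV n // w ≠ 0}}
    (h : Projectivization.mk' ℍ[ℝ] u = Projectivization.mk' ℍ[ℝ] w) {g : {g : ℍ[ℝ] // g ≠ 0}} :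
    orbit w g = u ↔ g = ratio u w h :=
  ⟨fun hg => orbit_injective w (hg.trans (orbit_ratio u w h).symm),
    fun hg => hg ▸ orbit_ratio u w h⟩

lemma continuous_ratio {Y : Type*} [TopologicalSpace Y] {f g : Y → {w : HV n // w ≠ 0}}
    (hf : Continuous f) (hg : Continuous g)
    (h : ∀ y, Projectivization.mk' ℍ[ℝ] (f y) = Projectivization.mk' ℍ[ℝ] (g y)) :
    Continuous fun y => ratio (f y) (g y) (h y) :=
  (continuous_coeff (continuous_subtype_val.comp hf) (continuous_subtype_val.comp hg)
    fun y => (g y).2).subtype_mk _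

lemma continuous_orbit {Y : Type*} [TopologicalSpace Y] {f : Y → {w : HV n // w ≠ 0}}
    {g : Y → {g : ℍ[ℝ] // g ≠ 0}} (hf : Continuous f) (hg : Continuous g) :
    Continuous fun y => orbit (f y) (g y) :=
  ((continuous_subtype_val.comp hg).smul (continuous_subtype_val.comp hf)).subtype_mk _

lemma mk'_liftNeZero_one (γ : Path y y) :
    Projectivization.mk' ℍ[ℝ] (liftNeZero hy γ 1) = Projectivization.mk' ℍ[ℝ] v := by
  rw [mk'_liftNeZero, γ.target, hy]

/-- The lift of a loop as a path ending in the fibre. -/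
noncomputable def liftPath (γ : Path y y) :
    Path v (orbit v (ratio (liftNeZero hy γ 1) v (mk'_liftNeZero_one hy γ))) where
  toFun := liftNeZero hy γ
  continuous_toFun := (continuous_liftNeZero hy).comp (Continuous.prodMk_right γ)
  source' := liftNeZero_zero hy γ
  target' := (orbit_ratio _ _ _).symm

/-- Loops lift to paths in the total space that end in the fibre. -/
noncomputable def liftPaths : C(Path y y, PathsTo v (orbit v)) where
  toFun γ := PathsTo.of _ (liftPath hy γ)
  continuous_toFun := PathsTo.continuous_of
    (continuous_ratio
      ((continuous_liftNeZero hy).comp (by fun_prop : Continuous fun γ : Path y y => (γ, (1 : I))))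
      continuous_const _)
    (continuous_liftNeZero hy)

lemma projectPaths_liftPaths (γ : Path y y) : projectPaths hy (liftPaths hy γ) = γ := by
  ext t
  exact mk'_liftNeZero hy γ t

lemma mk'_path_eq (p : PathsTo v (orbit v)) (s : I) :
    Projectivization.mk' ℍ[ℝ] (p.path s) =
      Projectivization.mk' ℍ[ℝ] (liftNeZero hy (projectPaths hy p) s) :=
  (mk'_liftNeZero hy (projectPaths hy p) s).symm

/-- The nonzero quaternion comparing a path with the lift of its projection. -/
noncomputable def pathRatio (p : PathsTo v (orbit v)) (s : I) : {g : ℍ[ℝ] // g ≠ 0} :=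
  ratio (p.path s) (liftNeZero hy (projectPaths hy p) s) (mk'_path_eq hy p s)

lemma continuous_liftNeZero_projectPaths : Continuous fun q : PathsTo v (orbit v) × I =>
    liftNeZero hy (projectPaths hy q.1) q.2 :=
  (continuous_liftNeZero hy).comp (f := fun q : PathsTo v (orbit v) × I =>
    (projectPaths hy q.1, q.2)) (by fun_prop)

lemma continuous_pathRatio :
    Continuous fun q : PathsTo v (orbit v) × I => pathRatio hy q.1 q.2 :=
  continuous_ratio PathsTo.continuous_path_eval (continuous_liftNeZero_projectPaths hy) _

lemma orbit_pathRatio (p : PathsTo v (orbit v)) (s : I) :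
    orbit (liftNeZero hy (projectPaths hy p) s) (pathRatio hy p s) = p.path s :=
  orbit_ratio _ _ _

lemma orbit_one (w : {w : HV n // w ≠ 0}) : orbit w ⟨1, one_ne_zero⟩ = w :=
  Subtype.ext (one_smul _ _)

/-- The product of nonzero quaternions. -/
noncomputable def mulNeZero (g h : {g : ℍ[ℝ] // g ≠ 0}) : {g : ℍ[ℝ] // g ≠ 0} :=
  ⟨g.1 * h.1, mul_ne_zero g.2 h.2⟩

lemma continuous_mulNeZero :
    Continuous fun q : {g : ℍ[ℝ] // g ≠ 0} × {g : ℍ[ℝ] // g ≠ 0} => mulNeZero q.1 q.2 :=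
  Continuous.subtype_mk (by fun_prop) _

lemma orbit_orbit (w : {w : HV n // w ≠ 0}) (g h : {g : ℍ[ℝ] // g ≠ 0}) :
    orbit (orbit w h) g = orbit w (mulNeZero g h) :=
  Subtype.ext (mul_smul _ _ _).symm

lemma pathRatio_zero (p : PathsTo v (orbit v)) : pathRatio hy p 0 = ⟨1, one_ne_zero⟩ := by
  refine ((orbit_eq_iff_ratio (mk'_path_eq hy p 0)).1 ?_).symm
  rw [orbit_one, liftNeZero_zero, p.path.source]

/-- The parameter of the deformation from `liftPaths` of the projection of `p` to `p`. -/
noncomputable def deformParam (s : I) (p : PathsTo v (orbit v)) : {g : ℍ[ℝ] // g ≠ 0} :=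
  mulNeZero (pathRatio hy p s) (liftPaths hy (projectPaths hy p)).param

lemma orbit_deformParam (s : I) (p : PathsTo v (orbit v)) :
    orbit v (deformParam hy s p) =
      orbit (liftNeZero hy (projectPaths hy p) 1) (pathRatio hy p s) := by
  rw [deformParam, ← orbit_orbit]
  exact congrArg (fun u => orbit u (pathRatio hy p s))
    (orbit_ratio _ _ (mk'_liftNeZero_one hy (projectPaths hy p)))

/-- The path of the deformation from `liftPaths` of the projection of `p` to `p`. -/
noncomputable def deformFun (s : I) (p : PathsTo v (orbit v)) (t : I) : {w : HV n // w ≠ 0} :=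
  orbit (liftNeZero hy (projectPaths hy p) t) (pathRatio hy p (s * t))

lemma continuous_deformFun : Continuous fun q : (I × PathsTo v (orbit v)) × I =>
    deformFun hy q.1.1 q.1.2 q.2 :=
  continuous_orbit
    ((continuous_liftNeZero_projectPaths hy).comp
      (f := fun q : (I × PathsTo v (orbit v)) × I => (q.1.2, q.2)) (by fun_prop))
    ((continuous_pathRatio hy).comp
      (f := fun q : (I × PathsTo v (orbit v)) × I => (q.1.2, q.1.1 * q.2)) (by fun_prop))

lemma deformFun_source (s : I) (p : PathsTo v (orbit v)) : deformFun hy s p 0 = v := by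
  rw [deformFun, mul_zero, pathRatio_zero, orbit_one, liftNeZero_zero]

lemma deformFun_target (s : I) (p : PathsTo v (orbit v)) :
    deformFun hy s p 1 = orbit v (deformParam hy s p) := by
  rw [deformFun, mul_one, orbit_deformParam]

/-- `deformFun` as a path. -/
noncomputable def deformPath (s : I) (p : PathsTo v (orbit v)) :
    Path v (orbit v (deformParam hy s p)) :=
  ⟨⟨deformFun hy s p, (continuous_deformFun hy).comp
    (f := fun t : I => ((s, p), t)) (Continuous.prodMk_right _)⟩,
    deformFun_source hy s p, deformFun_target hy s p⟩

lemma continuous_deformParam : Continuous fun q : I × PathsTo v (orbit v) =>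
    deformParam hy q.1 q.2 := by
  have h1 : Continuous fun q : I × PathsTo v (orbit v) => pathRatio hy q.2 q.1 :=
    (continuous_pathRatio hy).comp (f := fun q : I × PathsTo v (orbit v) => (q.2, q.1))
      (by fun_prop)
  have h2 : Continuous fun p : PathsTo v (orbit v) => (liftPaths hy (projectPaths hy p)).param :=
    PathsTo.continuous_param.comp ((liftPaths hy).continuous.comp (projectPaths hy).continuous)
  exact continuous_mulNeZero.comp (h1.prodMk (h2.comp continuous_snd))

lemma continuous_of_deformPath : Continuous fun q : I × PathsTo v (orbit v) =>
    PathsTo.of (deformParam hy q.1 q.2) (deformPath hy q.1 q.2) :=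
  PathsTo.continuous_of (continuous_deformParam hy) (continuous_deformFun hy)

lemma of_deformPath_zero (p : PathsTo v (orbit v)) :
    PathsTo.of (deformParam hy 0 p) (deformPath hy 0 p) = liftPaths hy (projectPaths hy p) := by
  refine PathsTo.ext' (Subtype.ext ?_) fun t => ?_
  · rw [PathsTo.of_param, deformParam, pathRatio_zero]
    exact one_mul _
  · change deformFun hy 0 p t = liftNeZero hy (projectPaths hy p) t
    rw [deformFun, zero_mul, pathRatio_zero, orbit_one]

lemma of_deformPath_one (p : PathsTo v (orbit v)) :
    PathsTo.of (deformParam hy 1 p) (deformPath hy 1 p) = p := by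
  refine PathsTo.ext' (orbit_injective v ?_) fun t => ?_
  · rw [PathsTo.of_param, orbit_deformParam, orbit_pathRatio, p.path.target]
  · change deformFun hy 1 p t = p.path t
    rw [deformFun, one_mul, orbit_pathRatio]

/-- The homotopy from the lift of the projection of a path to the path itself. -/
noncomputable def liftProjectHomotopy :
    ((liftPaths hy).comp (projectPaths hy)).Homotopy (.id _) where
  toFun q := PathsTo.of (deformParam hy q.1 q.2) (deformPath hy q.1 q.2)
  continuous_toFun := continuous_of_deformPath hy
  map_zero_left := of_deformPath_zero hy
  map_one_left := of_deformPath_one hy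

/-- Loops in projective space are equivalent to paths in the total space ending in the fibre. -/
noncomputable def loopEquiv : Path y y ≃ₕ PathsTo v (orbit v) where
  toFun := liftPaths hy
  invFun := projectPaths hy
  left_inv := homotopic_of_eq (ContinuousMap.ext (projectPaths_liftPaths hy))
  right_inv := ⟨liftProjectHomotopy hy⟩

/-- If `n ≥ 1`, the inclusion of a fibre is null-homotopic. -/
lemma exists_contraction_orbit (hn : 1 ≤ n) (v : {w : HV n // w ≠ 0}) :
    ∃ (w : {w : HV n // w ≠ 0}) (h : ∀ g, Path (orbit v g) w),
      Continuous fun q : {g : ℍ[ℝ] // g ≠ 0} × I => h q.1 q.2 := by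
  obtain ⟨i, hi⟩ := Function.ne_iff.1 v.2
  have : Nontrivial (Fin (n + 1)) := Fin.nontrivial_iff_two_le.2 (by omega)
  obtain ⟨j, hj⟩ := exists_ne i
  let w : HV n := Pi.single j 1
  have hw : w ≠ 0 := by simp [w]
  have hne (g : {g : ℍ[ℝ] // g ≠ 0}) (t : I) :
      ((1 - t : ℝ) • (g.1 • v.1) + (t : ℝ) • w : HV n) ≠ 0 := by
    intro h
    have hi' : (1 - t : ℝ) • (g.1 * v.1 i) = 0 := by
      simpa [w, hj.symm] using congrFun h i
    have ht : (1 - t : ℝ) = 0 :=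
      (smul_eq_zero.1 hi').resolve_right (mul_ne_zero g.2 hi)
    have ht' : (t : ℝ) = 1 := by linarith
    rw [ht, ht', zero_smul, one_smul, zero_add] at h
    exact hw h
  have hc : Continuous fun q : {g : ℍ[ℝ] // g ≠ 0} × I =>
      (⟨(1 - q.2 : ℝ) • (q.1.1 • v.1) + (q.2 : ℝ) • w, hne q.1 q.2⟩ : {w : HV n // w ≠ 0}) :=
    Continuous.subtype_mk (by fun_prop) _
  refine ⟨⟨w, hw⟩, fun g =>
    { toFun := fun t => ⟨(1 - t : ℝ) • (g.1 • v.1) + (t : ℝ) • w, hne g t⟩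
      continuous_toFun := hc.comp (Continuous.prodMk_right g)
      source' := ?_
      target' := ?_ }, hc⟩
  · simp [orbit]
  · simp

end QuaternionicProjectiveSpace

end QuaternionicProjectiveSpace

/-- for `n ≥ 1`, the based loop space `Ω(HP^n)` is homotopy equivalent to
the product `Ω(S^{4n+3}) × S³`.  Here `HP^n` is the quaternionic projective space
`ℙ(ℍ, ℍ^{n+1})` with the quotient topology, `S^{4n+3} ⊆ ℝ^{4n+4}` and `S³ ⊆ ℝ⁴` are
unit spheres, and the based loop space of `X` at `x` is the space `Path x x` of loops
at `x` (with the compact-open topology); the basepoints are arbitrary since all spaces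
involved are path-connected. -/
theorem stmt_0 (n : ℕ) (hn : 1 ≤ n)
    (y : Projectivization ℍ[ℝ] (Fin (n + 1) → ℍ[ℝ]))
    (s : Metric.sphere (0 : EuclideanSpace ℝ (Fin (4 * n + 4))) 1) :
    Nonempty (HomotopyEquiv (Path y y)
      ((Path s s) × (Metric.sphere (0 : EuclideanSpace ℝ (Fin 4)) 1))) := by
  obtain ⟨w, h, hh⟩ :=
    QuaternionicProjectiveSpace.exists_contraction_orbit hn ⟨y.rep, y.rep_nonzero⟩
  have hV : Module.finrank ℝ (Fin (n + 1) → ℍ[ℝ]) = 4 * n + 4 := by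
    rw [Module.finrank_pi_fintype]
    simp [Quaternion.finrank_eq_four]
    ring
  obtain ⟨e⟩ := nonempty_path_ne_zero_equiv_sphere
    (hV.trans finrank_euclideanSpace_fin.symm) (by omega) ⟨y.rep, y.rep_nonzero⟩ w s
  have eG : {g : ℍ[ℝ] // g ≠ 0} ≃ₕ Metric.sphere (0 : EuclideanSpace ℝ (Fin 4)) 1 :=
    (neZeroHomeomorph
      (Quaternion.finrank_eq_four.trans finrank_euclideanSpace_fin.symm)).toHomotopyEquiv.trans
      (sphereEquiv _).symm
  exact ⟨((((QuaternionicProjectiveSpace.loopEquiv y.mk_rep).trans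
    (PathsTo.concatEquiv h hh)).trans
    (PathsTo.constHomeomorph _ w).toHomotopyEquiv).trans (eG.prodCongr e)).trans
    (Homeomorph.prodComm _ _).toHomotopyEquiv⟩
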